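/- arXiv:2506.06501 — 3 statements merged into one kernel-verified Lean document; each statement's English description precedes it below -/
import Mathlib

section
/- Let M ≥ 1, β > 0, and let f(·; m) : ℝ^d → ℝ for m = 1,…,M be convex and β-smooth, with average F(w) = (1/M)Σ_{m=1}^M f(w; m). Let k ≥ 2, and let surrogates \tilde f^{(t)}(·; m) : ℝ^d → ℝ for t = 1,…,k, m = 1,…,M be convex and β-smooth. Assume joint realizability: there exists w⋆ ∈ ℝ^d such that f(w⋆; m) = 0 = min_w f(w; m) and \tilde f^{(t)}(w⋆; m) = 0 = min_w \tilde f^{(t)}(w; m) for all t, m. Assume there exist ν_t ≥ 0 such that for all t, m, w: \tilde f^{(t)}(w; m) − \tilde f^{(t)}(w⋆; m) ≤ f(w; m) − f(w⋆; m) ≤ (1 + ν_t β)(\tilde f^{(t)}(w; m) − \tilde f^{(t)}(w⋆; m)). Let 0 < η ≤ 3/(13β), set η_t = η·(k−t+2)/(k+1), and assume ν_t ≤ η_t for all t. Let τ_1,…,τ_k be i.i.d. uniform on {1,…,M}, fix w_0 ∈ ℝ^d, and set w_t = w_{t−1} − η_t ∇\tilde f^{(t)}(w_{t−1}; τ_t)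 for t = 1,…,k. Then the expected average loss of the final iterate over the tasks seen along the run satisfies E[(1/k)Σ_{t=1}^k (f(w_k; τ_t) − f(w⋆; τ_t))] ≤ 20‖w_0 − w⋆‖²/(η(k+1)); in particular, with η = 3/(13β), this expectation is at most 87β‖w_0 − w⋆‖²/(k+1). -/
section
variable {E : Type*} [NormedAddCommGroup E] [InnerProductSpace ℝ E] [CompleteSpace E]

theorem aux_line (h : E → ℝ) (hd : Differentiable ℝ h) (v d : E) (s : ℝ) :
    HasDerivAt (fun s : ℝ => h (v + s • d)) (inner ℝ (gradient h (v + s • d)) d) s := by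
  have h1 := (hd (v + s • d)).hasGradientAt.hasFDerivAt
  have h2 : HasDerivAt (fun s : ℝ => v + s • d) d s := by
    simpa using ((hasDerivAt_id s).smul_const d).const_add v
  have := h1.comp_hasDerivAt s h2
  rw [InnerProductSpace.toDual_apply_apply] at this
  exact this

theorem aux_descent (h : E → ℝ) (hd : Differentiable ℝ h) (β : ℝ)
    (hs : ∀ u v, ‖gradient h u - gradient h v‖ ≤ β * ‖u - v‖) (v d : E) :
    h (v + d) ≤ h v + inner ℝ (gradient h v) d + β / 2 * ‖d‖ ^ 2 := by
  have hder : ∀ s : ℝ, HasDerivAt (fun s : ℝ => h (v + s • d) - s * inner ℝ (gradient h v) d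
      - s ^ 2 * (β / 2 * ‖d‖ ^ 2))
      (inner ℝ (gradient h (v + s • d)) d - 1 * inner ℝ (gradient h v) d
      - (2 * s) * (β / 2 * ‖d‖ ^ 2)) s := by
    intro s
    refine ((aux_line h hd v d s).sub ((hasDerivAt_id s).mul_const _)).sub ?_
    simpa using (hasDerivAt_pow 2 s).mul_const (β / 2 * ‖d‖ ^ 2)
  have hanti : AntitoneOn (fun s : ℝ => h (v + s • d) - s * inner ℝ (gradient h v) d
      - s ^ 2 * (β / 2 * ‖d‖ ^ 2)) (Set.Icc 0 1) := by
    apply antitoneOn_of_deriv_nonpos (convex_Icc 0 1)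
    · exact fun s _ => (hder s).continuousAt.continuousWithinAt
    · exact fun s _ => (hder s).differentiableAt.differentiableWithinAt
    · intro s hs'
      rw [interior_Icc] at hs'
      rw [(hder s).deriv, one_mul, ← inner_sub_left]
      have h1 := real_inner_le_norm (gradient h (v + s • d) - gradient h v) d
      have h2 := hs (v + s • d) v
      rw [add_sub_cancel_left, norm_smul, Real.norm_of_nonneg hs'.1.le] at h2
      nlinarith [mul_le_mul_of_nonneg_right h2 (norm_nonneg d)]
  have := hanti (by simp : (0:ℝ) ∈ Set.Icc (0:ℝ) 1) (by simp : (1:ℝ) ∈ Set.Icc (0:ℝ) 1) zero_le_one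
  simp only [one_smul, zero_smul, add_zero] at this
  linarith

theorem aux_convex (h : E → ℝ) (hd : Differentiable ℝ h) (hc : ConvexOn ℝ Set.univ h) (v d : E) :
    h v + inner ℝ (gradient h v) d ≤ h (v + d) := by
  have hc' : ConvexOn ℝ Set.univ (fun s : ℝ => h (v + s • d)) := by
    refine ⟨convex_univ, fun x _ y _ a b ha hb hab => ?_⟩
    have := hc.2 (Set.mem_univ (v + x • d)) (Set.mem_univ (v + y • d)) ha hb hab
    convert this using 2
    have : v = (a + b) • v := by rw [hab, one_smul]
    simp only [smul_eq_mul]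
    nth_rewrite 1 [this]
    module
  have h0 := aux_line h hd v d 0
  have := hc'.le_slope_of_hasDerivAt (Set.mem_univ 0) (Set.mem_univ 1) zero_lt_one h0
  simp only [slope_def_field, one_smul, zero_smul, add_zero, sub_zero, div_one] at this
  linarith

theorem aux_coco (h : E → ℝ) (hd : Differentiable ℝ h) (hc : ConvexOn ℝ Set.univ h)
    (β : ℝ) (hβ : 0 < β)
    (hs : ∀ u v, ‖gradient h u - gradient h v‖ ≤ β * ‖u - v‖) (u v : E) :
    ‖gradient h u - gradient h v‖ ^ 2 ≤
      2 * β * (h u - h v - inner ℝ (gradient h v) (u - v)) := by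
  set g := gradient h u - gradient h v with hg
  have h1 := aux_descent h hd β hs u (-(β⁻¹) • g)
  have h2 := aux_convex h hd hc v (u - v + -(β⁻¹) • g)
  have e : v + (u - v + -(β⁻¹) • g) = u + -(β⁻¹) • g := by abel
  rw [e] at h2
  rw [inner_add_right] at h2
  rw [norm_smul, mul_pow] at h1
  simp only [inner_smul_right, norm_neg, norm_inv, Real.norm_eq_abs, abs_of_pos hβ] at h1 h2
  have h3 : inner ℝ (gradient h u) g - inner ℝ (gradient h v) g = ‖g‖ ^ 2 := by
    rw [← inner_sub_left, ← hg, real_inner_self_eq_norm_sq]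
  have h4 : h v + inner ℝ (gradient h v) (u - v) ≤ h u - β⁻¹ * ‖g‖ ^ 2 + β / 2 * ((β⁻¹) ^ 2 * ‖g‖ ^ 2) := by
    rw [← h3]; rw [← h3] at h1; linarith
  have h5 : β / 2 * ((β⁻¹) ^ 2 * ‖g‖ ^ 2) = β⁻¹ * ‖g‖ ^ 2 / 2 := by field_simp
  have h6 : β⁻¹ * ‖g‖ ^ 2 ≤ 2 * (h u - h v - inner ℝ (gradient h v) (u - v)) := by linarith
  calc ‖g‖ ^ 2 = β * (β⁻¹ * ‖g‖ ^ 2) := by field_simp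
    _ ≤ β * (2 * (h u - h v - inner ℝ (gradient h v) (u - v))) := by gcongr
    _ = _ := by ring

/-- gradient steps are nonexpansive -/
theorem aux_nonexp (h : E → ℝ) (hd : Differentiable ℝ h) (hc : ConvexOn ℝ Set.univ h)
    (β : ℝ) (hβ : 0 < β)
    (hs : ∀ u v, ‖gradient h u - gradient h v‖ ≤ β * ‖u - v‖) (η : ℝ) (h0 : 0 ≤ η)
    (h1 : η * β ≤ 1) (u v : E) :
    ‖(u - η • gradient h u) - (v - η • gradient h v)‖ ≤ ‖u - v‖ := by
  have a := aux_coco h hd hc β hβ hs u v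
  have b := aux_coco h hd hc β hβ hs v u
  rw [norm_sub_rev] at b
  have c : inner ℝ (gradient h u) (v - u) = - inner ℝ (gradient h u) (u - v) := by
    rw [← inner_neg_right, neg_sub]
  rw [c] at b
  have e : (u - η • gradient h u) - (v - η • gradient h v)
      = (u - v) - η • (gradient h u - gradient h v) := by module
  have i : inner ℝ (u - v) (gradient h u - gradient h v)
    = inner ℝ (gradient h u) (u - v) - inner ℝ (gradient h v) (u - v) := by
    rw [← inner_sub_left, real_inner_comm]
  refine (sq_le_sq₀ (norm_nonneg _) (norm_nonneg _)).1 ?_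
  rw [e, norm_sub_sq_real, inner_smul_right, norm_smul, mul_pow, i, Real.norm_of_nonneg h0]
  set G := ‖gradient h u - gradient h v‖ ^ 2 with hG
  have hG0 : 0 ≤ G := by positivity
  set I := inner ℝ (gradient h u) (u - v) - inner ℝ (gradient h v) (u - v) with hI
  have k1 : G ≤ β * I := by linarith
  have hI0 : 0 ≤ I := by
    by_contra hh; push Not at hh; nlinarith
  have k2 : η * G ≤ I := by nlinarith
  nlinarith

theorem aux_grad_min (h : E → ℝ) (ws : E) (hmin : ∀ w, h ws ≤ h w) :
    gradient h ws = 0 := by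
  have : fderiv ℝ h ws = 0 := IsLocalMin.fderiv_eq_zero (Filter.Eventually.of_forall hmin)
  simp [gradient, this]

theorem aux_grad_sq (h : E → ℝ) (hd : Differentiable ℝ h) (hc : ConvexOn ℝ Set.univ h)
    (β : ℝ) (hβ : 0 < β)
    (hs : ∀ u v, ‖gradient h u - gradient h v‖ ≤ β * ‖u - v‖) (ws : E)
    (h0 : h ws = 0) (hmin : ∀ w, h ws ≤ h w) (u : E) :
    ‖gradient h u‖ ^ 2 ≤ 2 * β * h u := by
  have := aux_coco h hd hc β hβ hs u ws
  rw [aux_grad_min h ws hmin, h0] at this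
  simpa using this

theorem aux_two (h : E → ℝ) (hd : Differentiable ℝ h) (hc : ConvexOn ℝ Set.univ h)
    (β : ℝ) (hβ : 0 < β)
    (hs : ∀ u v, ‖gradient h u - gradient h v‖ ≤ β * ‖u - v‖) (ws : E)
    (h0 : h ws = 0) (hmin : ∀ w, h ws ≤ h w) (u v : E) :
    h u ≤ 2 * h v + β * ‖u - v‖ ^ 2 := by
  have a := aux_descent h hd β hs v (u - v)
  have b := aux_grad_sq h hd hc β hβ hs ws h0 hmin v
  rw [add_sub_cancel] at a
  have c := real_inner_le_norm (gradient h v) (u - v)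
  have d : ‖gradient h v‖ * ‖u - v‖ ≤ h v + β / 2 * ‖u - v‖ ^ 2 := by
    have : 0 ≤ (‖gradient h v‖ - β * ‖u - v‖) ^ 2 := sq_nonneg _
    have k : β * (‖gradient h v‖ * ‖u - v‖) ≤ β * (h v + β / 2 * ‖u - v‖ ^ 2) := by nlinarith
    exact le_of_mul_le_mul_left k hβ
  linarith

theorem aux_step (h : E → ℝ) (hd : Differentiable ℝ h) (hc : ConvexOn ℝ Set.univ h)
    (β : ℝ) (hβ : 0 < β)
    (hs : ∀ u v, ‖gradient h u - gradient h v‖ ≤ β * ‖u - v‖) (ws : E)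
    (h0 : h ws = 0) (hmin : ∀ w, h ws ≤ h w) (η : ℝ) (hη : 0 ≤ η) (x z : E) :
    ‖x - η • gradient h x - z‖ ^ 2 ≤ ‖x - z‖ ^ 2 - 2 * η * ((1 - β * η) * h x - h z) := by
  have a := aux_convex h hd hc x (z - x)
  have b := aux_grad_sq h hd hc β hβ hs ws h0 hmin x
  rw [add_sub_cancel] at a
  have c : inner ℝ (x - z) (gradient h x) = - inner ℝ (gradient h x) (z - x) := by
    rw [← inner_neg_right, neg_sub, real_inner_comm]
  have e : x - η • gradient h x - z = (x - z) - η • gradient h x := by abel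
  rw [e, norm_sub_sq_real, inner_smul_right, norm_smul, mul_pow, c, Real.norm_of_nonneg hη]
  nlinarith [mul_le_mul_of_nonneg_left b (sq_nonneg η), mul_le_mul_of_nonneg_left a hη]

/-- one step with the sandwich -/
theorem aux_step_sand (h f : E → ℝ) (hd : Differentiable ℝ h) (hc : ConvexOn ℝ Set.univ h)
    (β : ℝ) (hβ : 0 < β)
    (hs : ∀ u v, ‖gradient h u - gradient h v‖ ≤ β * ‖u - v‖) (ws : E)
    (h0 : h ws = 0) (hmin : ∀ w, h ws ≤ h w) (η ν : ℝ) (hη : 0 ≤ η) (hη1 : β * η ≤ 1)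
    (hνη : ν ≤ η)
    (hsand : ∀ w, h w ≤ f w ∧ f w ≤ (1 + ν * β) * h w) (x z : E) :
    ‖x - η • gradient h x - z‖ ^ 2 ≤
      ‖x - z‖ ^ 2 - 2 * η * ((1 - 2 * β * η) * f x - f z) := by
  have a := aux_step h hd hc β hβ hs ws h0 hmin η hη x z
  have hx0 : 0 ≤ h x := h0 ▸ hmin x
  have h1 := (hsand x).2
  have h2 := (hsand z).1
  have hf0 : 0 ≤ f x := hx0.trans (hsand x).1
  have h3 : f x ≤ (1 + β * η) * h x := h1.trans (by
    apply mul_le_mul_of_nonneg_right _ hx0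
    nlinarith)
  have p : 0 ≤ β * η := by positivity
  have h4 : (1 - β * η) * f x ≤ h x := by
    nlinarith [mul_le_mul_of_nonneg_left h3 (sub_nonneg.2 hη1), mul_nonneg (sq_nonneg (β * η)) hx0]
  have h5 : (1 - 2 * β * η) * f x ≤ (1 - β * η) * h x := by
    nlinarith [mul_le_mul_of_nonneg_left h4 (sub_nonneg.2 hη1), mul_nonneg (sq_nonneg (β * η)) hf0]
  nlinarith [mul_le_mul_of_nonneg_left h5 hη, mul_le_mul_of_nonneg_left h2 hη]

theorem aux_step_star (h : E → ℝ) (hd : Differentiable ℝ h) (hc : ConvexOn ℝ Set.univ h)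
    (β : ℝ) (hβ : 0 < β)
    (hs : ∀ u v, ‖gradient h u - gradient h v‖ ≤ β * ‖u - v‖) (ws : E)
    (h0 : h ws = 0) (hmin : ∀ w, h ws ≤ h w) (η : ℝ) (hη : 0 ≤ η) (hη1 : β * η ≤ 1) (x : E) :
    ‖x - η • gradient h x - ws‖ ^ 2 ≤ ‖x - ws‖ ^ 2 - 2 * η * h x := by
  have a := aux_coco h hd hc β hβ hs ws x
  rw [aux_grad_min h ws hmin, h0, zero_sub, norm_neg] at a
  have c : inner ℝ (x - ws) (gradient h x) = - inner ℝ (gradient h x) (ws - x) := by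
    rw [← inner_neg_right, neg_sub, real_inner_comm]
  have e : x - η • gradient h x - ws = (x - ws) - η • gradient h x := by abel
  rw [e, norm_sub_sq_real, inner_smul_right, norm_smul, mul_pow, c, Real.norm_of_nonneg hη]
  set G := ‖gradient h x‖ ^ 2 with hG
  have hG0 : 0 ≤ G := by positivity
  set J := -inner ℝ (gradient h x) (ws - x) with hJ
  have k : G ≤ 2 * β * (J - h x) := by linarith
  have k0 : 0 ≤ J - h x := by
    by_contra hh; push Not at hh; nlinarith
  have k2 : η * G ≤ 2 * (J - h x) := by nlinarith [mul_le_mul_of_nonneg_left k hη]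
  nlinarith [mul_le_mul_of_nonneg_left k2 hη]
end

theorem aux_avg {k M : ℕ} (t : Fin k) (G : (Fin k → Fin M) → Fin M → ℝ)
    (hG : ∀ τ m m', G (Function.update τ t m') m = G τ m) :
    (M : ℝ) * ∑ τ, G τ (τ t) = ∑ τ, ∑ m, G τ m := by
  let φ : (Fin k → Fin M) × Fin M → (Fin k → Fin M) × Fin M :=
    fun p => (Function.update p.1 t p.2, p.1 t)
  have hφ : Function.Involutive φ := by
    rintro ⟨τ, m⟩
    simp [φ]
  have h1 : ∑ p : (Fin k → Fin M) × Fin M, G (φ p).1 ((φ p).1 t)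
      = ∑ p : (Fin k → Fin M) × Fin M, G p.1 (p.1 t) :=
    Equiv.sum_comp hφ.toPerm (fun p => G p.1 (p.1 t))
  rw [Fintype.sum_prod_type, Fintype.sum_prod_type] at h1
  simp only [φ, Function.update_self, hG] at h1
  rw [h1]
  simp [Finset.mul_sum]

/-- the telescoping real-sequence argument -/
theorem aux_seq (k : ℕ) (β η : ℝ) (hη : 0 < η) (hβη : β * η ≤ 3 / 13)
    (A F Z C e : ℕ → ℝ)
    (hC : ∀ t, C t = 1 / ((k : ℝ) + 2 - t) + 1 / ((k : ℝ) + 1))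
    (he : ∀ t, e t = η * (((k : ℝ) - t + 1) / ((k : ℝ) + 1)))
    (hF : ∀ t, 0 ≤ F t) (hA : ∀ t, 0 ≤ A t) (hZ0 : Z 0 = 0)
    (hstep : ∀ t < k, C (t + 1) ^ 2 * A (t + 1) ≤ C t ^ 2 * A t
      - 2 * e t * C (t + 1) ^ 2 * ((1 - 2 * β * e t) * F t - Z (t + 1)))
    (hlast : 0 ≤ C k ^ 2 * A k
      - 2 * e k * C (k + 1) ^ 2 * ((1 - 2 * β * e k) * F k - Z (k + 1)))
    (hZ : ∀ t ≤ k, C (t + 1) * Z (t + 1) ≤ C t * Z t + (C (t + 1) - C t) * F t) :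
    F k ≤ 4 * A 0 / (η * ((k : ℝ) + 1)) := by
  let R : ℕ → ℝ := fun t => η / ((k : ℝ) + 1) *
    (((k : ℝ) + 1 - t) + ((k : ℝ) + 1 - t) * ((k : ℝ) + 2 - t) / (2 * ((k : ℝ) + 1)))
  have hR : ∀ t ≤ k, R t = e t * C (t + 1) + R (t + 1) := by
    intro t ht
    have htk : (t : ℝ) ≤ k := by exact_mod_cast ht
    simp only [R, hC, he]
    push_cast
    have h1 : (k : ℝ) + 2 - (t + 1) ≠ 0 := by linarith
    have h2 : (k : ℝ) + 1 ≠ 0 := by positivity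
    field_simp
    ring
  have hR0 : ∀ t ≤ k, 0 ≤ R t := by
    intro t ht
    have htk : (t : ℝ) ≤ k := by exact_mod_cast ht
    have h1 : 0 ≤ (k : ℝ) + 1 - t := by linarith
    have h2 : 0 ≤ (k : ℝ) + 2 - t := by linarith
    simp only [R]
    positivity
  have hbr : ∀ t ≤ k, R t * (C (t + 1) - C t) - e t * C (t + 1) ^ 2 * (1 - 2 * β * e t)
      ≤ η / ((k : ℝ) + 1) * (1 / ((k : ℝ) + 2 - t) - 1 / ((k : ℝ) + 1 - t)) := by
    intro t ht
    have htk : (t : ℝ) ≤ k := by exact_mod_cast ht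
    set T : ℝ := (k : ℝ) + 1 with hT
    have hTpos : 0 < T := by positivity
    obtain ⟨n, hn⟩ : ∃ n : ℝ, n = T - t := ⟨_, rfl⟩
    have hn1 : 0 < n := by rw [hn, hT]; linarith
    have ht0 : (0 : ℝ) ≤ t := by positivity
    have hnT : n ≤ T := by rw [hn]; linarith
    have e1 : R t = η / T * (n + n * (n + 1) / (2 * T)) := by
      simp only [R, hn, hT]; ring
    have e2 : C (t + 1) = 1 / n + 1 / T := by
      rw [hC, hn, hT]; push_cast; congr 2; ring
    have e3 : C t = 1 / (n + 1) + 1 / T := by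
      rw [hC, hn, hT]; congr 2; ring
    have e4 : e t = η * (n / T) := by
      rw [he, hn, hT]; congr 2; ring
    have e5 : (k : ℝ) + 2 - t = n + 1 := by rw [hn, hT]; ring
    rw [e1, e2, e3, e4, e5, ← hn]
    obtain ⟨x, hx⟩ : ∃ x : ℝ, x = n / T := ⟨_, rfl⟩
    have hx0 : 0 < x := by rw [hx]; positivity
    have hx1 : x ≤ 1 := by rw [hx, div_le_one hTpos]; exact hnT
    have key : 1 + x / 2 ≤ (1 + x) ^ 2 * (1 - 2 * (β * η) * x) := by
      have : (1 + x) ^ 2 * (1 - 2 * (3 / 13) * x) ≤ (1 + x) ^ 2 * (1 - 2 * (β * η) * x) := by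
        gcongr
      nlinarith [mul_nonneg hx0.le (sub_nonneg.2 hx1), mul_nonneg (mul_nonneg hx0.le hx0.le) (sub_nonneg.2 hx1)]
    have id1 : η / T * (n + n * (n + 1) / (2 * T)) * (1 / n + 1 / T - (1 / (n + 1) + 1 / T))
        = η / T * (1 / (n + 1) + x / (2 * n)) := by
      rw [hx]; field_simp; ring
    have id2 : η * (n / T) * (1 / n + 1 / T) ^ 2 * (1 - 2 * β * (η * (n / T)))
        = η / T * (1 / n * ((1 + x) ^ 2 * (1 - 2 * (β * η) * x))) := by
      rw [hx]; field_simp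
    rw [id1, id2, ← mul_sub]
    apply mul_le_mul_of_nonneg_left _ (by positivity)
    have : 1 / n * (1 + x / 2) ≤ 1 / n * ((1 + x) ^ 2 * (1 - 2 * (β * η) * x)) := by gcongr
    have e6 : 1 / n * (1 + x / 2) = 1 / n + x / (2 * n) := by field_simp
    linarith
  have hinc : ∀ t ≤ k, η / ((k : ℝ) + 1) * (1 / ((k : ℝ) + 2 - t) - 1 / ((k : ℝ) + 1 - t)) ≤ 0 := by
    intro t ht
    have htk : (t : ℝ) ≤ k := by exact_mod_cast ht
    apply mul_nonpos_of_nonneg_of_nonpos (by positivity)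
    rw [sub_nonpos]
    apply one_div_le_one_div_of_le <;> linarith
  have hΦ : ∀ t ≤ k, C t ^ 2 * A t + 2 * R t * (C t * Z t) ≤ C 0 ^ 2 * A 0 := by
    intro t
    induction t with
    | zero => intro _; simp [hZ0]
    | succ t ih =>
      intro ht
      have i := ih (by omega)
      have a := hstep t (by omega)
      have b := hZ t (by omega)
      have c := (hbr t (by omega)).trans (hinc t (by omega))
      have r := hR t (by omega)
      have r0 := hR0 t (by omega)
      have r1 : R (t + 1) = R t - e t * C (t + 1) := by linarith
      rw [r1]
      nlinarith [mul_le_mul_of_nonneg_left b r0, mul_nonneg (neg_nonneg.2 c) (hF t)]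
  have i := hΦ k le_rfl
  have b := hZ k le_rfl
  have c := hbr k le_rfl
  have r := hR k le_rfl
  have r0 := hR0 k le_rfl
  have r1 : R (k + 1) = 0 := by simp [R]
  rw [r1, add_zero] at r
  have c' : η / ((k : ℝ) + 1) * (1 / ((k : ℝ) + 2 - k) - 1 / ((k : ℝ) + 1 - k))
      = - (η / ((k : ℝ) + 1)) / 2 := by
    rw [add_sub_cancel_left, add_sub_cancel_left]; ring
  rw [c'] at c
  have main : η / ((k : ℝ) + 1) * F k ≤ C 0 ^ 2 * A 0 := by
    rw [r] at i c r0
    nlinarith [mul_le_mul_of_nonneg_left b r0, mul_le_mul_of_nonneg_right c (hF k)]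
  have hC0 : C 0 ^ 2 ≤ 4 / ((k : ℝ) + 1) ^ 2 := by
    have h1 : C 0 ≤ 2 / ((k : ℝ) + 1) := by
      rw [hC]
      have : 1 / ((k : ℝ) + 2 - (0 : ℕ)) ≤ 1 / ((k : ℝ) + 1) := by
        apply one_div_le_one_div_of_le (by positivity); simp
      rw [show (2 : ℝ) / ((k : ℝ) + 1) = 1 / ((k : ℝ) + 1) + 1 / ((k : ℝ) + 1) by ring]
      linarith
    have h0 : 0 ≤ C 0 := by rw [hC]; simp; positivity
    calc C 0 ^ 2 ≤ (2 / ((k : ℝ) + 1)) ^ 2 := by gcongr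
      _ = _ := by rw [div_pow]; norm_num
  have fin := main.trans (mul_le_mul_of_nonneg_right hC0 (hA 0))
  rw [le_div_iff₀ (by positivity)]
  have hT : (0 : ℝ) < (k : ℝ) + 1 := by positivity
  have := mul_le_mul_of_nonneg_left fin (sq_nonneg ((k : ℝ) + 1))
  have e1 : ((k : ℝ) + 1) ^ 2 * (η / ((k : ℝ) + 1) * F k) = F k * (η * ((k : ℝ) + 1)) := by
    field_simp
  have e2 : ((k : ℝ) + 1) ^ 2 * (4 / ((k : ℝ) + 1) ^ 2 * A 0) = 4 * A 0 := by field_simp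
  linarith

section
variable {E : Type*} [NormedAddCommGroup E] [InnerProductSpace ℝ E]

def auxIter (P : ℕ → E → E) (w0 : E) : ℕ → E
  | 0 => w0
  | n + 1 => P n (auxIter P w0 n)

noncomputable def auxZ (C : ℕ → ℝ) (x : ℕ → E) (ws : E) : ℕ → E
  | 0 => ws
  | n + 1 => (C n / C (n + 1)) • auxZ C x ws n + (1 - C n / C (n + 1)) • x n

theorem aux_stab (k : ℕ) (P : ℕ → E → E) (hP : ∀ i u v, ‖P i u - P i v‖ ≤ ‖u - v‖)
    (x : ℕ → E) (hx : ∀ i < k, x (i + 1) = P i (x i)) (t : ℕ) (ht : t < k) :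
    ‖x k - auxIter (fun i u => if i = t then u else P i u) (x 0) k‖ ≤ ‖x (t + 1) - x t‖ := by
  set y := auxIter (fun i u => if i = t then u else P i u) (x 0) with hy
  have ys : ∀ i, y (i + 1) = if i = t then y i else P i (y i) := fun i => rfl
  have h1 : ∀ i ≤ t, y i = x i := by
    intro i
    induction i with
    | zero => intro _; rfl
    | succ i ih =>
      intro hi
      rw [ys, if_neg (by omega), ih (by omega), hx i (by omega)]
  have h2 : ∀ j, t + 1 + j ≤ k → ‖x (t + 1 + j) - y (t + 1 + j)‖ ≤ ‖x (t + 1) - x t‖ := by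
    intro j
    induction j with
    | zero => intro _; rw [add_zero, ys, if_pos rfl, h1 t le_rfl]
    | succ j ih =>
      intro hj
      rw [← add_assoc, ys, if_neg (by omega), hx _ (by omega)]
      exact (hP _ _ _).trans (ih (by omega))
  have := h2 (k - (t + 1)) (by omega)
  rwa [show t + 1 + (k - (t + 1)) = k by omega] at this

theorem auxZ_congr (C : ℕ → ℝ) (x x' : ℕ → E) (ws : E) (n : ℕ) (h : ∀ i < n, x i = x' i) :
    auxZ C x ws n = auxZ C x' ws n := by
  induction n with
  | zero => rfl
  | succ n ih =>
    rw [auxZ, auxZ, ih (fun i hi => h i (by omega)), h n (by omega)]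

theorem auxZ_norm (C : ℕ → ℝ) (x : ℕ → E) (ws : E) (n : ℕ) (h : 0 < C (n + 1)) :
    C (n + 1) ^ 2 * ‖x n - auxZ C x ws (n + 1)‖ ^ 2 = C n ^ 2 * ‖x n - auxZ C x ws n‖ ^ 2 := by
  have : x n - auxZ C x ws (n + 1) = (C n / C (n + 1)) • (x n - auxZ C x ws n) := by
    rw [auxZ]; module
  rw [this, norm_smul, mul_pow, Real.norm_eq_abs, sq_abs]
  field_simp

theorem auxZ_convex (C : ℕ → ℝ) (x : ℕ → E) (ws : E) (n : ℕ) (h0 : 0 < C n)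
    (h : C n ≤ C (n + 1)) (g : E → ℝ) (hg : ConvexOn ℝ Set.univ g) :
    C (n + 1) * g (auxZ C x ws (n + 1)) ≤
      C n * g (auxZ C x ws n) + (C (n + 1) - C n) * g (x n) := by
  have h1 : 0 < C (n + 1) := h0.trans_le h
  have p1 : 0 ≤ C n / C (n + 1) := by positivity
  have p2 : 0 ≤ 1 - C n / C (n + 1) := sub_nonneg.2 ((div_le_one h1).2 h)
  have := hg.2 (Set.mem_univ (auxZ C x ws n)) (Set.mem_univ (x n)) p1 p2 (by ring)
  have := mul_le_mul_of_nonneg_left this h1.le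
  rw [auxZ]
  refine this.trans (le_of_eq ?_)
  simp only [smul_eq_mul]
  field_simp
end

/-- seen-task loss guarantee for SGD on time-varying surrogate losses
with the linearly decaying step sizes `η_t = η(k−t+2)/(k+1)` (below `t` is 0-indexed,
so step `t` uses `η·((k−t)+1)/(k+1)`):
`E[(1/k)Σ_t (f(w_k;τ_t) − f(w⋆;τ_t))] ≤ 20‖w₀−w⋆‖²/(η(k+1))`, and with `η = 3/(13β)`
this is at most `87β‖w₀−w⋆‖²/(k+1)`. -/
theorem sgd_time_varying_seen_task_loss {d M : ℕ} (hM : 1 ≤ M)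
    (β : ℝ) (hβ : 0 < β)
    (f : Fin M → EuclideanSpace ℝ (Fin d) → ℝ)
    (hfdiff : ∀ m, Differentiable ℝ (f m))
    (hfconv : ∀ m, ConvexOn ℝ Set.univ (f m))
    (hfsmooth : ∀ (m : Fin M) (u v : EuclideanSpace ℝ (Fin d)),
      ‖gradient (f m) u - gradient (f m) v‖ ≤ β * ‖u - v‖)
    (k : ℕ) (hk : 2 ≤ k)
    (tf : Fin k → Fin M → EuclideanSpace ℝ (Fin d) → ℝ)
    (htfdiff : ∀ t m, Differentiable ℝ (tf t m))
    (htfconv : ∀ t m, ConvexOn ℝ Set.univ (tf t m))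
    (htfsmooth : ∀ (t : Fin k) (m : Fin M) (u v : EuclideanSpace ℝ (Fin d)),
      ‖gradient (tf t m) u - gradient (tf t m) v‖ ≤ β * ‖u - v‖)
    (wstar : EuclideanSpace ℝ (Fin d))
    (hfreal : ∀ m, f m wstar = 0 ∧ ∀ w, f m wstar ≤ f m w)
    (htfreal : ∀ t m, tf t m wstar = 0 ∧ ∀ w, tf t m wstar ≤ tf t m w)
    (ν : Fin k → ℝ) (hν : ∀ t, 0 ≤ ν t)
    (hsand : ∀ (t : Fin k) (m : Fin M) (w : EuclideanSpace ℝ (Fin d)),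
      tf t m w - tf t m wstar ≤ f m w - f m wstar ∧
      f m w - f m wstar ≤ (1 + ν t * β) * (tf t m w - tf t m wstar))
    (η : ℝ) (hηpos : 0 < η) (hηle : η ≤ 3 / (13 * β))
    (ηt : Fin k → ℝ)
    (hηt : ∀ t : Fin k, ηt t = η * (((k : ℝ) - (t.1 : ℝ) + 1) / ((k : ℝ) + 1)))
    (hνη : ∀ t, ν t ≤ ηt t)
    (w0 : EuclideanSpace ℝ (Fin d))
    (w : (Fin k → Fin M) → ℕ → EuclideanSpace ℝ (Fin d))
    (hw0 : ∀ τ, w τ 0 = w0)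
    (hwt : ∀ (τ : Fin k → Fin M) (t : Fin k),
      w τ (t.1 + 1) = w τ t.1 - ηt t • gradient (tf t (τ t)) (w τ t.1)) :
    (∑ τ : Fin k → Fin M,
        (1 / (k : ℝ)) * ∑ t : Fin k, (f (τ t) (w τ k) - f (τ t) wstar))
        / (M : ℝ) ^ k
      ≤ 20 * ‖w0 - wstar‖ ^ 2 / (η * ((k : ℝ) + 1)) ∧
    (η = 3 / (13 * β) →
      (∑ τ : Fin k → Fin M,
          (1 / (k : ℝ)) * ∑ t : Fin k, (f (τ t) (w τ k) - f (τ t) wstar))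
          / (M : ℝ) ^ k
        ≤ 87 * β * ‖w0 - wstar‖ ^ 2 / ((k : ℝ) + 1)) := by
  have hMR : (0 : ℝ) < M := by exact_mod_cast hM
  have hkR : (2 : ℝ) ≤ k := by exact_mod_cast hk
  have hβη : β * η ≤ 3 / 13 := by
    calc β * η ≤ β * (3 / (13 * β)) := by gcongr
      _ = 3 / 13 := by field_simp
  -- step sizes on ℕ
  obtain ⟨e, he⟩ : ∃ e : ℕ → ℝ, ∀ t, e t = η * (((k : ℝ) - t + 1) / ((k : ℝ) + 1)) := ⟨_, fun _ => rfl⟩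
  have hee : ∀ t : Fin k, ηt t = e t.1 := fun t => by rw [hηt, he]
  have he0 : ∀ t ≤ k, 0 ≤ e t := by
    intro t ht
    have htk : (t : ℝ) ≤ k := by exact_mod_cast ht
    have : 0 ≤ (k : ℝ) - t + 1 := by linarith
    rw [he]; positivity
  have heη : ∀ t, e t ≤ η := by
    intro t
    have : (0 : ℝ) ≤ t := by positivity
    rw [he]
    apply mul_le_of_le_one_right hηpos.le
    rw [div_le_one (by positivity)]
    linarith
  have hβe : ∀ t, β * e t ≤ 1 := fun t =>
    (mul_le_mul_of_nonneg_left (heη t) hβ.le).trans (hβη.trans (by norm_num))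
  obtain ⟨C, hC⟩ : ∃ C : ℕ → ℝ, ∀ t, C t = 1 / ((k : ℝ) + 2 - t) + 1 / ((k : ℝ) + 1) :=
    ⟨_, fun _ => rfl⟩
  have hC0 : ∀ t ≤ k + 1, 0 < C t := by
    intro t ht
    have htk : (t : ℝ) ≤ k + 1 := by exact_mod_cast ht
    have : 0 < (k : ℝ) + 2 - t := by linarith
    rw [hC]; positivity
  have hCmono : ∀ t ≤ k, C t ≤ C (t + 1) := by
    intro t ht
    have htk : (t : ℝ) ≤ k := by exact_mod_cast ht
    rw [hC, hC]
    gcongr 1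
    apply one_div_le_one_div_of_le <;> push_cast <;> linarith
  have hf0 : ∀ m x, 0 ≤ f m x := fun m x => (hfreal m).1 ▸ (hfreal m).2 x
  have htf0 : ∀ t m x, 0 ≤ tf t m x := fun t m x => (htfreal t m).1 ▸ (htfreal t m).2 x
  have hsand' : ∀ t m x, tf t m x ≤ f m x ∧ f m x ≤ (1 + ν t * β) * tf t m x := by
    intro t m x
    have := hsand t m x
    rw [(hfreal m).1, (htfreal t m).1, sub_zero, sub_zero] at this
    exact this
  -- independence
  have hwind : ∀ (t : Fin k) (m : Fin M) (τ : Fin k → Fin M) (s : ℕ), s ≤ t.1 →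
      w (Function.update τ t m) s = w τ s := by
    intro t m τ s
    induction s with
    | zero => intro _; rw [hw0, hw0]
    | succ s ih =>
      intro hs
      have hsk : s < k := by have := t.2; omega
      have hne : (⟨s, hsk⟩ : Fin k) ≠ t := by
        intro h; rw [← h] at hs; simp at hs
      have a := hwt (Function.update τ t m) ⟨s, hsk⟩
      have b := hwt τ ⟨s, hsk⟩
      simp only [Function.update_of_ne hne, ih (by omega)] at a b
      rw [a, b]
  let z : (Fin k → Fin M) → ℕ → EuclideanSpace ℝ (Fin d) := fun τ => auxZ C (w τ) wstar
  have hzind : ∀ (t : Fin k) (m : Fin M) (τ : Fin k → Fin M),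
      z (Function.update τ t m) (t.1 + 1) = z τ (t.1 + 1) := by
    intro t m τ
    exact auxZ_congr _ _ _ _ _ (fun i hi => hwind t m τ i (by omega))
  -- last iterate bound
  have hlastit : (∑ τ, ∑ m, f m (w τ k)) ≤
      4 * ((M : ℝ) * ∑ τ, ‖w τ 0 - z τ 0‖ ^ 2) / (η * ((k : ℝ) + 1)) := by
    refine aux_seq k β η hηpos hβη (fun t => (M : ℝ) * ∑ τ, ‖w τ t - z τ t‖ ^ 2)
      (fun t => ∑ τ, ∑ m, f m (w τ t)) (fun t => ∑ τ, ∑ m, f m (z τ t)) C e hC he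
      ?_ ?_ ?_ ?_ ?_ ?_
    · exact fun t => Finset.sum_nonneg fun τ _ => Finset.sum_nonneg fun m _ => hf0 _ _
    · intro t; positivity
    · simp [z, auxZ, (hfreal _).1]
    · intro t ht
      have a1 := aux_avg ⟨t, ht⟩ (fun τ m => f m (w τ t))
        (fun τ m m' => by simp only [hwind ⟨t, ht⟩ m' τ t le_rfl])
      have a2 := aux_avg ⟨t, ht⟩ (fun τ m => f m (z τ (t + 1)))
        (fun τ m m' => by simp only [hzind ⟨t, ht⟩ m' τ])
      rw [← a1, ← a2]
      have key : ∀ τ, C (t + 1) ^ 2 * ‖w τ (t + 1) - z τ (t + 1)‖ ^ 2 ≤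
          C t ^ 2 * ‖w τ t - z τ t‖ ^ 2 - 2 * e t * C (t + 1) ^ 2 *
            ((1 - 2 * β * e t) * f (τ ⟨t, ht⟩) (w τ t) - f (τ ⟨t, ht⟩) (z τ (t + 1))) := by
        intro τ
        have b1 := auxZ_norm C (w τ) wstar t (hC0 _ (by omega))
        have b2 := aux_step_sand (tf ⟨t, ht⟩ (τ ⟨t, ht⟩)) (f (τ ⟨t, ht⟩)) (htfdiff _ _)
          (htfconv _ _) β hβ (htfsmooth _ _) wstar (htfreal _ _).1 (htfreal _ _).2 (e t)
          (ν ⟨t, ht⟩) (he0 t ht.le) (hβe t) (by rw [← hee ⟨t, ht⟩]; exact hνη _)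
          (hsand' _ _) (w τ t) (z τ (t + 1))
        have b3 := hwt τ ⟨t, ht⟩
        rw [hee] at b3
        simp only at b3
        rw [← b3] at b2
        have b4 := mul_le_mul_of_nonneg_left b2 (sq_nonneg (C (t + 1)))
        rw [mul_sub, b1] at b4
        refine b4.trans (le_of_eq ?_)
        ring
      have s1 := mul_le_mul_of_nonneg_left (Finset.sum_le_sum fun τ (_ : τ ∈ Finset.univ) => key τ)
        hMR.le
      rw [Finset.sum_sub_distrib, ← Finset.mul_sum, ← Finset.mul_sum, ← Finset.mul_sum,
        Finset.sum_sub_distrib, ← Finset.mul_sum] at s1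
      linarith
    · have key : ∀ τ m, 0 ≤ C k ^ 2 * ‖w τ k - z τ k‖ ^ 2 - 2 * e k * C (k + 1) ^ 2 *
            ((1 - 2 * β * e k) * f m (w τ k) - f m (z τ (k + 1))) := by
        intro τ m
        have b1 := auxZ_norm C (w τ) wstar k (hC0 _ (by omega))
        have b2 := aux_step_sand (f m) (f m) (hfdiff _)
          (hfconv _) β hβ (hfsmooth _) wstar (hfreal _).1 (hfreal _).2 (e k)
          0 (he0 k le_rfl) (hβe k) (he0 k le_rfl)
          (fun x => by simp) (w τ k) (z τ (k + 1))
        have b4 := mul_le_mul_of_nonneg_left ((sq_nonneg _).trans b2) (sq_nonneg (C (k + 1)))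
        rw [mul_sub, b1] at b4
        refine (le_of_eq (by ring)).trans (b4.trans (le_of_eq ?_))
        ring
      have s1 : 0 ≤ ∑ τ, ∑ m, (C k ^ 2 * ‖w τ k - z τ k‖ ^ 2 - 2 * e k * C (k + 1) ^ 2 *
            ((1 - 2 * β * e k) * f m (w τ k) - f m (z τ (k + 1)))) :=
        Finset.sum_nonneg fun τ _ => Finset.sum_nonneg fun m _ => key τ m
      simp only [Finset.sum_sub_distrib, ← Finset.mul_sum, Finset.sum_const, Finset.card_univ,
        Fintype.card_fin, nsmul_eq_mul] at s1
      linarith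
    · intro t ht
      simp only [Finset.mul_sum, ← Finset.sum_add_distrib]
      refine Finset.sum_le_sum fun τ _ => Finset.sum_le_sum fun m _ => ?_
      exact auxZ_convex C (w τ) wstar t (hC0 _ (by omega)) (hCmono t ht) (f m) (hfconv m)
  have hlast2 : (∑ τ, ∑ m, f m (w τ k)) ≤
      (M : ℝ) ^ k * M * (4 * ‖w0 - wstar‖ ^ 2 / (η * ((k : ℝ) + 1))) := by
    refine hlastit.trans (le_of_eq ?_)
    simp only [hw0, z, auxZ, Finset.sum_const, Finset.card_univ, Fintype.card_pi_const,
      Fintype.card_fin, nsmul_eq_mul]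
    push_cast
    ring
  -- regret along every path
  have hregret : ∀ τ, ∑ t : Fin k, 2 * e t.1 * tf t (τ t) (w τ t.1) ≤ ‖w0 - wstar‖ ^ 2 := by
    intro τ
    have hstep : ∀ t : Fin k, 2 * e t.1 * tf t (τ t) (w τ t.1) ≤
        ‖w τ t.1 - wstar‖ ^ 2 - ‖w τ (t.1 + 1) - wstar‖ ^ 2 := by
      intro t
      have b2 := aux_step_star (tf t (τ t)) (htfdiff _ _)
          (htfconv _ _) β hβ (htfsmooth _ _) wstar (htfreal _ _).1 (htfreal _ _).2 (e t)
          (he0 t t.2.le) (hβe t) (w τ t)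
      rw [hwt τ t, hee]
      linarith
    refine (Finset.sum_le_sum fun t _ => hstep t).trans ?_
    rw [Fin.sum_univ_eq_sum_range
      (fun i => ‖w τ i - wstar‖ ^ 2 - ‖w τ (i + 1) - wstar‖ ^ 2) k, Finset.sum_range_sub', hw0]
    have : 0 ≤ ‖w τ k - wstar‖ ^ 2 := by positivity
    linarith
  -- skipped iterates
  let P : (Fin k → Fin M) → ℕ → EuclideanSpace ℝ (Fin d) → EuclideanSpace ℝ (Fin d) :=
    fun τ i x => if h : i < k then x - e i • gradient (tf ⟨i, h⟩ (τ ⟨i, h⟩)) x else x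
  have hP : ∀ τ i u v, ‖P τ i u - P τ i v‖ ≤ ‖u - v‖ := by
    intro τ i u v
    by_cases h : i < k
    · simp only [P, dif_pos h]
      exact aux_nonexp _ (htfdiff _ _) (htfconv _ _) β hβ (htfsmooth _ _) (e i) (he0 i h.le)
        (by rw [mul_comm]; exact hβe i) u v
    · simp only [P, dif_neg h, le_refl]
  let y : Fin k → (Fin k → Fin M) → EuclideanSpace ℝ (Fin d) :=
    fun t τ => auxIter (fun i u => if i = t.1 then u else P τ i u) w0 k
  have hyind : ∀ t τ m, y t (Function.update τ t m) = y t τ := by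
    intro t τ m
    simp only [y]
    congr 1
    funext i u
    by_cases hi : i = t.1
    · simp [hi]
    · simp only [if_neg hi, P]
      by_cases h : i < k
      · have hne : (⟨i, h⟩ : Fin k) ≠ t := by
          intro hh; rw [← hh] at hi; simp at hi
        simp only [dif_pos h, Function.update_of_ne hne]
      · simp only [dif_neg h]
  have hyd : ∀ t τ, ‖w τ k - y t τ‖ ^ 2 ≤ β * η * (2 * e t.1 * tf t (τ t) (w τ t.1)) := by
    intro t τ
    have a := aux_stab k (P τ) (hP τ) (w τ) (fun i hi => by
      simp only [P, dif_pos hi]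
      rw [hwt τ ⟨i, hi⟩, hee]) t.1 t.2
    rw [hw0] at a
    have b := hwt τ t
    rw [b, hee, sub_sub_cancel_left, norm_neg, norm_smul, Real.norm_of_nonneg (he0 _ t.2.le)] at a
    have c := aux_grad_sq (tf t (τ t)) (htfdiff _ _)
          (htfconv _ _) β hβ (htfsmooth _ _) wstar (htfreal _ _).1 (htfreal _ _).2 (w τ t.1)
    calc ‖w τ k - y t τ‖ ^ 2 ≤ (e t.1 * ‖gradient (tf t (τ t)) (w τ t.1)‖) ^ 2 := by
          gcongr
      _ = e t.1 * (e t.1 * ‖gradient (tf t (τ t)) (w τ t.1)‖ ^ 2) := by ring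
      _ ≤ η * (e t.1 * (2 * β * tf t (τ t) (w τ t.1))) := by
          have := he0 t.1 t.2.le
          have := heη t.1
          gcongr
      _ = _ := by ring
  have hseen : ∀ t : Fin k, (M : ℝ) * ∑ τ : Fin k → Fin M, f (τ t) (w τ k) ≤
      4 * (∑ τ, ∑ m, f m (w τ k)) + 3 * M * β * ∑ τ, ‖w τ k - y t τ‖ ^ 2 := by
    intro t
    have a : ∀ τ, f (τ t) (w τ k) ≤ 2 * f (τ t) (y t τ) + β * ‖w τ k - y t τ‖ ^ 2 := fun τ =>
      aux_two _ (hfdiff _) (hfconv _) β hβ (hfsmooth _) wstar (hfreal _).1 (hfreal _).2 _ _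
    have b : ∀ τ m, f m (y t τ) ≤ 2 * f m (w τ k) + β * ‖w τ k - y t τ‖ ^ 2 := fun τ m => by
      rw [norm_sub_rev]
      exact aux_two _ (hfdiff _) (hfconv _) β hβ (hfsmooth _) wstar (hfreal _).1 (hfreal _).2 _ _
    have c := aux_avg t (fun τ m => f m (y t τ)) (fun τ m m' => by simp only [hyind])
    have a' := mul_le_mul_of_nonneg_left (Finset.sum_le_sum fun τ (_ : τ ∈ Finset.univ) => a τ)
        hMR.le
    have b' := Finset.sum_le_sum fun τ (_ : τ ∈ Finset.univ) =>
      Finset.sum_le_sum fun m (_ : m ∈ Finset.univ) => b τ m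
    simp only [Finset.sum_add_distrib, ← Finset.mul_sum, Finset.sum_const, Finset.card_univ,
        Fintype.card_fin, nsmul_eq_mul] at a' b' c
    linarith
  have hsum : (∑ τ : Fin k → Fin M, ∑ t : Fin k, f (τ t) (w τ k)) ≤
      (M : ℝ) ^ k * (k * (16 * ‖w0 - wstar‖ ^ 2 / (η * ((k : ℝ) + 1)))
        + 3 * β * (β * η) * ‖w0 - wstar‖ ^ 2) := by
    have a := Finset.sum_le_sum fun t (_ : t ∈ Finset.univ) => hseen t
    simp only [Finset.sum_add_distrib, ← Finset.mul_sum, Finset.sum_const, Finset.card_univ,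
        Fintype.card_fin, nsmul_eq_mul] at a
    rw [Finset.sum_comm, Finset.sum_comm (f := fun t τ => ‖w τ k - y t τ‖ ^ 2)] at a
    have b : (∑ τ : Fin k → Fin M, ∑ t : Fin k, ‖w τ k - y t τ‖ ^ 2) ≤
        (M : ℝ) ^ k * (β * η * ‖w0 - wstar‖ ^ 2) := by
      have : ∀ τ : Fin k → Fin M, ∑ t : Fin k, ‖w τ k - y t τ‖ ^ 2 ≤ β * η * ‖w0 - wstar‖ ^ 2 := by
        intro τ
        refine (Finset.sum_le_sum fun t _ => hyd t τ).trans ?_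
        rw [← Finset.mul_sum]
        exact mul_le_mul_of_nonneg_left (hregret τ) (by positivity)
      refine (Finset.sum_le_sum fun τ _ => this τ).trans (le_of_eq ?_)
      simp
    have c : (M : ℝ) * (∑ τ : Fin k → Fin M, ∑ t : Fin k, f (τ t) (w τ k)) ≤ M *
      ((M : ℝ) ^ k * (k * (16 * ‖w0 - wstar‖ ^ 2 / (η * ((k : ℝ) + 1)))
        + 3 * β * (β * η) * ‖w0 - wstar‖ ^ 2)) := by
      refine a.trans ?_
      calc _ ≤ 4 * ((k : ℝ) * ((M : ℝ) ^ k * M * (4 * ‖w0 - wstar‖ ^ 2 / (η * ((k : ℝ) + 1)))))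
            + 3 * M * β * ((M : ℝ) ^ k * (β * η * ‖w0 - wstar‖ ^ 2)) := by gcongr
        _ = _ := by ring
    exact le_of_mul_le_mul_left c hMR
  have hfinal : (∑ τ : Fin k → Fin M,
        (1 / (k : ℝ)) * ∑ t : Fin k, (f (τ t) (w τ k) - f (τ t) wstar))
        / (M : ℝ) ^ k
      ≤ 20 * ‖w0 - wstar‖ ^ 2 / (η * ((k : ℝ) + 1)) := by
    simp only [(hfreal _).1, sub_zero]
    rw [← Finset.mul_sum, div_le_iff₀ (by positivity), one_div, inv_mul_le_iff₀ (by positivity)]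
    refine hsum.trans ?_
    have h1 : 3 * β * (β * η) * ‖w0 - wstar‖ ^ 2 ≤
        k * (4 * ‖w0 - wstar‖ ^ 2 / (η * ((k : ℝ) + 1))) := by
      rw [← mul_div_assoc, le_div_iff₀ (by positivity)]
      have h2 : (β * η) ^ 2 ≤ (3 / 13) ^ 2 := by gcongr
      have h3 : 3 * (β * η) ^ 2 * ((k : ℝ) + 1) ≤ k * 4 := by
        calc 3 * (β * η) ^ 2 * ((k : ℝ) + 1) ≤ 3 * (3 / 13) ^ 2 * ((k : ℝ) + 1) := by gcongr
          _ ≤ (k : ℝ) * 4 := by linarith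
      have := mul_le_mul_of_nonneg_right h3 (sq_nonneg ‖w0 - wstar‖)
      linarith
    calc _ ≤ (M : ℝ) ^ k * (k * (16 * ‖w0 - wstar‖ ^ 2 / (η * ((k : ℝ) + 1)))
        + k * (4 * ‖w0 - wstar‖ ^ 2 / (η * ((k : ℝ) + 1)))) := by gcongr
      _ = _ := by ring
  refine ⟨hfinal, fun hη => hfinal.trans ?_⟩
  have : 20 * ‖w0 - wstar‖ ^ 2 / (η * ((k : ℝ) + 1)) =
      (260 / 3 * β * ‖w0 - wstar‖ ^ 2) / ((k : ℝ) + 1) := by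
    rw [hη]; field_simp; ring
  rw [this]
  gcongr
  norm_num
end

section
/- Let J ≥ 1, M ≥ 1, β > 0, w⋆ ∈ ℝ^d, and let f(·; m) : ℝ^d → ℝ for m = 1,…,M be convex and β-smooth with f(w⋆; m) = 0 = min_w f(w; m) for all m. Let \tilde f^{(t)}(·; m) : ℝ^d → ℝ for t = 1,…,J be convex and differentiable, and suppose there exist ν_t ≥ 0 such that for all t, m, w: \tilde f^{(t)}(w; m) − \tilde f^{(t)}(w⋆; m) ≤ f(w; m) − f(w⋆; m) ≤ (1 + ν_t β)(\tilde f^{(t)}(w; m) − \tilde f^{(t)}(w⋆; m)). Let τ_1,…,τ_J be i.i.d. uniform on {1,…,M}, let step sizes satisfy η_t ≥ ν_t, fix w_1 ∈ ℝ^d, and set w_{t+1} = w_t − η_t ∇\tilde f^{(t)}(w_t; τ_t) for t = 1,…,J. Define \tilde F_t(w) = (1/M)Σ_{m=1}^M \tilde f^{(t)}(w; m). Then for every weight sequence 0 < v_0 ≤ v_1 ≤ ⋯ ≤ v_J: Σ_{t=1}^J c_t·E[\tilde F_t(w_t) − \tilde F_t(w⋆)] ≤ (v_0²/2)‖w_1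 − w⋆‖² + (1/2)Σ_{t=1}^J η_t²v_t²·E‖∇\tilde f^{(t)}(w_t; τ_t)‖², where c_t = η_t v_t² − (1 + η_t β)(v_t − v_{t−1})·Σ_{s=t}^J η_s v_s. -/
lemma avg_swap {J M : ℕ} (hM : 1 ≤ M) (t : Fin J) (G : (Fin J → Fin M) → Fin M → ℝ)
    (hG : ∀ τ k m, G (Function.update τ t k) m = G τ m) :
    ∑ τ : Fin J → Fin M, (1 / (M : ℝ)) * ∑ m, G τ m = ∑ τ : Fin J → Fin M, G τ (τ t) := by
  have hM' : (M : ℝ) ≠ 0 := by positivity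
  have key : ∑ p : (Fin J → Fin M) × Fin M, G p.1 p.2
      = ∑ p : (Fin J → Fin M) × Fin M, G p.1 (p.1 t) := by
    let i : (Fin J → Fin M) × Fin M → (Fin J → Fin M) × Fin M :=
      fun p => (Function.update p.1 t p.2, p.1 t)
    have hi : Function.Involutive i := by
      intro p
      simp [i]
    refine Fintype.sum_equiv hi.toPerm _ _ ?_
    intro p
    simp [i, hG]
  rw [Fintype.sum_prod_type, Fintype.sum_prod_type] at key
  rw [← Finset.mul_sum, key]
  simp only [Finset.sum_const, Finset.card_univ, Fintype.card_fin, nsmul_eq_mul]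
  rw [← Finset.mul_sum]
  field_simp

/-- the reference points -/
noncomputable def refPt {E : Type*} [AddCommGroup E] [Module ℝ E] (v : ℕ → ℝ) (ws : E)
    (w : ℕ → E) : ℕ → E
  | 0 => ws
  | n + 1 => (v n / v (n + 1)) • refPt v ws w n + (1 - v n / v (n + 1)) • w n

lemma refPt_congr {E : Type*} [AddCommGroup E] [Module ℝ E] (v : ℕ → ℝ) (ws : E)
    (w w' : ℕ → E) (n : ℕ) (h : ∀ i < n, w i = w' i) : refPt v ws w n = refPt v ws w' n := by
  induction n with
  | zero => rfl
  | succ n ih =>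
    simp only [refPt]
    rw [ih (fun i hi => h i (by omega)), h n (by omega)]

lemma refPt_conv {E : Type*} [AddCommGroup E] [Module ℝ E] (v : ℕ → ℝ) (ws : E)
    (w : ℕ → E) (φ : E → ℝ) (hφ : ConvexOn ℝ Set.univ φ) (J : ℕ)
    (hvpos : ∀ i ≤ J, 0 < v i) (hvmono : ∀ i, i < J → v i ≤ v (i + 1)) (n : ℕ) (hn : n ≤ J) :
    v n * (φ (refPt v ws w n) - φ ws)
      ≤ ∑ s ∈ Finset.range n, (v (s + 1) - v s) * (φ (w s) - φ ws) := by
  induction n with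
  | zero => simp [refPt]
  | succ n ih =>
    have ih := ih (by omega)
    rw [Finset.sum_range_succ]
    have h1 := hvpos n (by omega)
    have h2 := hvpos (n + 1) hn
    have h3 := hvmono n (by omega)
    have hle : v n / v (n + 1) ≤ 1 := (div_le_one h2).2 h3
    have hc := hφ.2 (Set.mem_univ (refPt v ws w n)) (Set.mem_univ (w n))
      (div_nonneg h1.le h2.le) (sub_nonneg.2 hle) (by ring)
    simp only [smul_eq_mul] at hc
    have hc' := mul_le_mul_of_nonneg_left hc h2.le
    have e : v (n + 1) * (v n / v (n + 1) * φ (refPt v ws w n) + (1 - v n / v (n + 1)) * φ (w n))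
        = v n * φ (refPt v ws w n) + (v (n + 1) - v n) * φ (w n) := by
      field_simp
    rw [e] at hc'
    simp only [refPt]
    nlinarith

lemma grad_ineq {d : ℕ} (φ : EuclideanSpace ℝ (Fin d) → ℝ) (hφ : ConvexOn ℝ Set.univ φ)
    (hd : Differentiable ℝ φ) (x y : EuclideanSpace ℝ (Fin d)) :
    φ x - φ y ≤ inner ℝ (gradient φ x) (x - y) := by
  have hg := (hd x).hasGradientAt.hasFDerivAt
  let ψ : ℝ → ℝ := fun s => φ (AffineMap.lineMap x y s)
  have hψ : ConvexOn ℝ Set.univ ψ := by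
    exact hφ.comp_affineMap (AffineMap.lineMap x y)
  have hl : HasDerivAt (fun s : ℝ => AffineMap.lineMap x y s) (y - x) (0 : ℝ) :=
    AffineMap.hasDerivAt_lineMap
  have hg0 : HasFDerivAt φ (InnerProductSpace.toDual ℝ _ (gradient φ x))
      (AffineMap.lineMap x y (0 : ℝ)) := by simpa using hg
  have hψd : HasDerivAt ψ (inner ℝ (gradient φ x) (y - x)) 0 := by
    simpa [ψ, Function.comp_def] using hg0.comp_hasDerivAt (0 : ℝ) hl
  have := hψ.le_slope_of_hasDerivAt (Set.mem_univ 0) (Set.mem_univ 1) zero_lt_one hψd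
  simp only [slope_def_field, ψ, AffineMap.lineMap_apply_zero, AffineMap.lineMap_apply_one] at this
  have e : inner ℝ (gradient φ x) (x - y) = - inner ℝ (gradient φ x) (y - x) := by
    rw [← inner_neg_right, neg_sub]
  rw [e]
  rw [sub_zero, div_one] at this
  linarith

lemma step_ineq {E : Type*} [NormedAddCommGroup E] [InnerProductSpace ℝ E]
    (a b η δ : ℝ) (hb : 0 < b) (hη : 0 ≤ η) (w z g : E)
    (z' : E) (hz : z' = (a / b) • z + (1 - a / b) • w) (hδ : δ ≤ inner ℝ g (w - z')) :
    η * b ^ 2 * δ ≤ a ^ 2 / 2 * ‖w - z‖ ^ 2 - b ^ 2 / 2 * ‖w - η • g - z'‖ ^ 2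
      + 1 / 2 * (η ^ 2 * b ^ 2 * ‖g‖ ^ 2) := by
  have e1 : w - z' = (a / b) • (w - z) := by rw [hz]; module
  have e2 : b ^ 2 * ‖w - z'‖ ^ 2 = a ^ 2 * ‖w - z‖ ^ 2 := by
    rw [e1, norm_smul, mul_pow, Real.norm_eq_abs, sq_abs]
    field_simp
  have e3 : w - η • g - z' = (w - z') - η • g := by abel
  have e4 : ‖w - η • g - z'‖ ^ 2 = ‖w - z'‖ ^ 2 - 2 * (η * inner ℝ g (w - z')) + η ^ 2 * ‖g‖ ^ 2 := by
    rw [e3, norm_sub_sq_real, inner_smul_right, real_inner_comm, norm_smul, mul_pow,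
      Real.norm_eq_abs, sq_abs]
  rw [e4]
  have := mul_le_mul_of_nonneg_left hδ (mul_nonneg hη (sq_nonneg b))
  nlinarith

lemma sum_Iic_range {J : ℕ} (t : Fin J) (h : ℕ → ℝ) :
    ∑ s ∈ Finset.range (t.1 + 1), h s = ∑ s ∈ Finset.Iic t, h s.1 := by
  have : Finset.range (t.1 + 1) = (Finset.Iic t).map Fin.valEmbedding := by
    rw [Fin.map_valEmbedding_Iic]; ext; simp
  rw [this, Finset.sum_map]; rfl


/-- SGD bound for time-varying distributions (weighted regret-type
inequality). Iterates are 0-indexed below: `w τ 0 = w₁` and step `t` (0-indexed,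
corresponding to `t+1` in 1-indexed notation) uses step size `η t`, weight `v (t+1)`
for `v_t` and `v t` for `v_{t−1}`. The conclusion is
`Σ_t c_t E[\tilde F_t(w_t) − \tilde F_t(w⋆)] ≤ (v₀²/2)‖w₁−w⋆‖² + (1/2)Σ_t η_t²v_t² E‖∇\tilde f^{(t)}(w_t;τ_t)‖²`
with `c_t = η_t v_t² − (1 + η_t β)(v_t − v_{t−1})·Σ_{s=t}^J η_s v_s`. -/
theorem sgd_time_varying_weighted_bound {d M J : ℕ} (hJ : 1 ≤ J) (hM : 1 ≤ M)
    (β : ℝ) (hβ : 0 < β)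
    (wstar : EuclideanSpace ℝ (Fin d))
    (f : Fin M → EuclideanSpace ℝ (Fin d) → ℝ)
    (hfdiff : ∀ m, Differentiable ℝ (f m))
    (hfconv : ∀ m, ConvexOn ℝ Set.univ (f m))
    (hfsmooth : ∀ (m : Fin M) (u v : EuclideanSpace ℝ (Fin d)),
      ‖gradient (f m) u - gradient (f m) v‖ ≤ β * ‖u - v‖)
    (hfreal : ∀ m, f m wstar = 0 ∧ ∀ w, f m wstar ≤ f m w)
    (tf : Fin J → Fin M → EuclideanSpace ℝ (Fin d) → ℝ)
    (htfdiff : ∀ t m, Differentiable ℝ (tf t m))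
    (htfconv : ∀ t m, ConvexOn ℝ Set.univ (tf t m))
    (ν : Fin J → ℝ) (hν : ∀ t, 0 ≤ ν t)
    (hsand : ∀ (t : Fin J) (m : Fin M) (w : EuclideanSpace ℝ (Fin d)),
      tf t m w - tf t m wstar ≤ f m w - f m wstar ∧
      f m w - f m wstar ≤ (1 + ν t * β) * (tf t m w - tf t m wstar))
    (η : Fin J → ℝ) (hη : ∀ t, ν t ≤ η t)
    (w1 : EuclideanSpace ℝ (Fin d))
    (w : (Fin J → Fin M) → ℕ → EuclideanSpace ℝ (Fin d))
    (hw1 : ∀ τ, w τ 0 = w1)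
    (hwt : ∀ (τ : Fin J → Fin M) (t : Fin J),
      w τ (t.1 + 1) = w τ t.1 - η t • gradient (tf t (τ t)) (w τ t.1))
    (v : ℕ → ℝ) (hv0 : 0 < v 0) (hvmono : ∀ i, i < J → v i ≤ v (i + 1)) :
    ∑ t : Fin J,
      (η t * (v (t.1 + 1)) ^ 2 -
        (1 + η t * β) * (v (t.1 + 1) - v t.1) * ∑ s ∈ Finset.Ici t, η s * v (s.1 + 1)) *
      ((∑ τ : Fin J → Fin M,
          ((1 / (M : ℝ)) * ∑ m, tf t m (w τ t.1) - (1 / (M : ℝ)) * ∑ m, tf t m wstar))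
        / (M : ℝ) ^ J)
    ≤ (v 0) ^ 2 / 2 * ‖w1 - wstar‖ ^ 2 +
      (1 / 2) * ∑ t : Fin J,
        (η t) ^ 2 * (v (t.1 + 1)) ^ 2 *
          ((∑ τ : Fin J → Fin M, ‖gradient (tf t (τ t)) (w τ t.1)‖ ^ 2) / (M : ℝ) ^ J) := by
  have hvpos : ∀ i ≤ J, 0 < v i := by
    intro i hi
    induction i with
    | zero => exact hv0
    | succ n ih => exact lt_of_lt_of_le (ih (by omega)) (hvmono n (by omega))
  have hη0 : ∀ t, 0 ≤ η t := fun t => (hν t).trans (hη t)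
  have hMpos : (0 : ℝ) < M := by exact_mod_cast hM
  let z : (Fin J → Fin M) → ℕ → EuclideanSpace ℝ (Fin d) := fun τ => refPt v wstar (w τ)
  -- pathwise descent
  have P1 : ∀ τ, ∑ t : Fin J, η t * v (t.1 + 1) ^ 2 *
      (tf t (τ t) (w τ t.1) - tf t (τ t) (z τ (t.1 + 1))) ≤
      v 0 ^ 2 / 2 * ‖w1 - wstar‖ ^ 2 + (1 / 2) * ∑ t : Fin J,
        (η t) ^ 2 * (v (t.1 + 1)) ^ 2 * ‖gradient (tf t (τ t)) (w τ t.1)‖ ^ 2 := by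
    intro τ
    let a : ℕ → ℝ := fun n => v n ^ 2 / 2 * ‖w τ n - z τ n‖ ^ 2
    have hs : ∀ t : Fin J, η t * v (t.1 + 1) ^ 2 *
      (tf t (τ t) (w τ t.1) - tf t (τ t) (z τ (t.1 + 1))) ≤ -(a (t.1 + 1) - a t.1) + 1 / 2 *
        ((η t) ^ 2 * (v (t.1 + 1)) ^ 2 * ‖gradient (tf t (τ t)) (w τ t.1)‖ ^ 2) := by
      intro t
      have := step_ineq (v t.1) (v (t.1 + 1)) (η t) _ (hvpos _ t.2) (hη0 t) (w τ t.1) (z τ t.1)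
        (gradient (tf t (τ t)) (w τ t.1)) (z τ (t.1 + 1)) rfl
        (grad_ineq (tf t (τ t)) (htfconv _ _) (htfdiff _ _) _ _)
      rw [← hwt] at this
      simp only [a]
      linarith
    have h := Finset.sum_le_sum (s := Finset.univ) (fun t _ => hs t)
    rw [Finset.sum_add_distrib, Finset.sum_neg_distrib,
      Fin.sum_univ_eq_sum_range (fun n => a (n + 1) - a n), Finset.sum_range_sub,
      ← Finset.mul_sum] at h
    have ha : 0 ≤ a J := by simp only [a]; positivity
    have ha0 : a 0 = v 0 ^ 2 / 2 * ‖w1 - wstar‖ ^ 2 := by simp only [a, hw1]; rfl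
    linarith
  -- convexity
  have P2 : ∀ τ m, ∑ t : Fin J,
      (η t * (v (t.1 + 1)) ^ 2 -
        (1 + η t * β) * (v (t.1 + 1) - v t.1) * ∑ s ∈ Finset.Ici t, η s * v (s.1 + 1)) *
        (tf t m (w τ t.1) - tf t m wstar) ≤
      ∑ t : Fin J, η t * v (t.1 + 1) ^ 2 * (tf t m (w τ t.1) - tf t m (z τ (t.1 + 1))) := by
    intro τ m
    have hs : ∀ t : Fin J, η t * v (t.1 + 1) ^ 2 * (tf t m (z τ (t.1 + 1)) - tf t m wstar) ≤
        ∑ s ∈ Finset.Iic t, η t * v (t.1 + 1) *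
          ((1 + η s * β) * (v (s.1 + 1) - v s.1) * (tf s m (w τ s.1) - tf s m wstar)) := by
      intro t
      have h1 := refPt_conv v wstar (w τ) (tf t m) (htfconv t m) J hvpos hvmono (t.1 + 1) t.2
      rw [sum_Iic_range t (fun s => (v (s + 1) - v s) * (tf t m (w τ s) - tf t m wstar))] at h1
      have h2 : ∑ s ∈ Finset.Iic t, (v (s.1 + 1) - v s.1) * (tf t m (w τ s.1) - tf t m wstar) ≤
          ∑ s ∈ Finset.Iic t,
          ((1 + η s * β) * (v (s.1 + 1) - v s.1) * (tf s m (w τ s.1) - tf s m wstar)) := by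
        refine Finset.sum_le_sum fun s _ => ?_
        have a1 := (hsand t m (w τ s.1)).1
        have a2 := (hsand s m (w τ s.1)).2
        have a3 := (hfreal m).2 (w τ s.1)
        have a4 : 0 ≤ tf s m (w τ s.1) - tf s m wstar := by
          have : 0 < 1 + ν s * β := by have := mul_nonneg (hν s) hβ.le; linarith
          exact nonneg_of_mul_nonneg_right (a := 1 + ν s * β) (by linarith) this
        have a5 : (1 + ν s * β) * (tf s m (w τ s.1) - tf s m wstar) ≤
            (1 + η s * β) * (tf s m (w τ s.1) - tf s m wstar) := by
          have := hη s
          gcongr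
        have a6 : 0 ≤ v (s.1 + 1) - v s.1 := sub_nonneg.2 (hvmono s.1 s.2)
        calc _ ≤ (v (s.1 + 1) - v s.1) * ((1 + η s * β) * (tf s m (w τ s.1) - tf s m wstar)) :=
              mul_le_mul_of_nonneg_left (by linarith) a6
          _ = _ := by ring
      rw [← Finset.mul_sum]
      calc _ = η t * v (t.1 + 1) * (v (t.1 + 1) * (tf t m (z τ (t.1 + 1)) - tf t m wstar)) := by ring
        _ ≤ _ := mul_le_mul_of_nonneg_left (h1.trans h2)
              (mul_nonneg (hη0 t) (hvpos _ t.2).le)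
    have h := Finset.sum_le_sum (s := Finset.univ) (fun t _ => hs t)
    rw [Finset.sum_comm' (t' := Finset.univ) (s' := fun s => Finset.Ici s) (by simp)] at h
    have e : ∀ t : Fin J, (η t * (v (t.1 + 1)) ^ 2 -
        (1 + η t * β) * (v (t.1 + 1) - v t.1) * ∑ s ∈ Finset.Ici t, η s * v (s.1 + 1)) *
        (tf t m (w τ t.1) - tf t m wstar) =
        η t * v (t.1 + 1) ^ 2 * (tf t m (w τ t.1) - tf t m (z τ (t.1 + 1)))
        + η t * v (t.1 + 1) ^ 2 * (tf t m (z τ (t.1 + 1)) - tf t m wstar)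
        - ∑ s ∈ Finset.Ici t, η s * v (s.1 + 1) *
          ((1 + η t * β) * (v (t.1 + 1) - v t.1) * (tf t m (w τ t.1) - tf t m wstar)) := by
      intro t
      rw [← Finset.sum_mul]
      ring
    rw [Finset.sum_congr rfl (fun t _ => e t), Finset.sum_sub_distrib, Finset.sum_add_distrib]
    linarith
  -- adaptedness
  have hw_ad : ∀ (t : Fin J) (k : Fin M) τ, ∀ n ≤ t.1, w (Function.update τ t k) n = w τ n := by
    intro t k τ n hn
    induction n with
    | zero => rw [hw1, hw1]
    | succ n ih =>
      have hne : (⟨n, by omega⟩ : Fin J) ≠ t := by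
        intro h; rw [← h] at hn; simp at hn
      have q1 := hwt τ ⟨n, by omega⟩
      have q2 := hwt (Function.update τ t k) ⟨n, by omega⟩
      rw [Function.update_of_ne hne] at q2
      simp only at q1 q2
      rw [q1, q2, ih (by omega)]
  have hz_ad : ∀ (t : Fin J) (k : Fin M) τ, z (Function.update τ t k) (t.1 + 1) = z τ (t.1 + 1) := by
    intro t k τ
    exact refPt_congr _ _ _ _ _ (fun i hi => hw_ad t k τ i (by omega))
  have P3 : ∀ t : Fin J, ∑ τ : Fin J → Fin M, (1 / (M : ℝ)) * ∑ m,
      (tf t m (w τ t.1) - tf t m (z τ (t.1 + 1))) =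
      ∑ τ : Fin J → Fin M, (tf t (τ t) (w τ t.1) - tf t (τ t) (z τ (t.1 + 1))) := by
    intro t
    refine avg_swap hM t (fun τ m => tf t m (w τ t.1) - tf t m (z τ (t.1 + 1))) ?_
    intro τ k m
    simp only [hz_ad, hw_ad t k τ t.1 le_rfl]
  set c : Fin J → ℝ := fun t => η t * (v (t.1 + 1)) ^ 2 -
        (1 + η t * β) * (v (t.1 + 1) - v t.1) * ∑ s ∈ Finset.Ici t, η s * v (s.1 + 1) with hc
  have L : ∑ t : Fin J, c t * ∑ τ : Fin J → Fin M,
          ((1 / (M : ℝ)) * ∑ m, tf t m (w τ t.1) - (1 / (M : ℝ)) * ∑ m, tf t m wstar)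
      ≤ ∑ τ : Fin J → Fin M, ∑ t : Fin J, η t * v (t.1 + 1) ^ 2 *
      (tf t (τ t) (w τ t.1) - tf t (τ t) (z τ (t.1 + 1))) := by
    calc _ = ∑ τ : Fin J → Fin M, (1 / (M : ℝ)) * ∑ m, ∑ t : Fin J,
              c t * (tf t m (w τ t.1) - tf t m wstar) := by
          simp only [Finset.mul_sum, ← mul_sub, ← Finset.sum_sub_distrib]
          rw [Finset.sum_comm]
          refine Finset.sum_congr rfl fun τ _ => ?_
          rw [Finset.sum_comm]
          refine Finset.sum_congr rfl fun m _ => Finset.sum_congr rfl fun t _ => ?_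
          ring
      _ ≤ ∑ τ : Fin J → Fin M, (1 / (M : ℝ)) * ∑ m, ∑ t : Fin J,
              η t * v (t.1 + 1) ^ 2 * (tf t m (w τ t.1) - tf t m (z τ (t.1 + 1))) := by
          refine Finset.sum_le_sum fun τ _ => mul_le_mul_of_nonneg_left
            (Finset.sum_le_sum fun m _ => P2 τ m) (by positivity)
      _ = ∑ t : Fin J, η t * v (t.1 + 1) ^ 2 * ∑ τ : Fin J → Fin M, (1 / (M : ℝ)) * ∑ m,
            (tf t m (w τ t.1) - tf t m (z τ (t.1 + 1))) := by
          simp only [Finset.mul_sum]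
          rw [Finset.sum_comm (s := (Finset.univ : Finset (Fin J)))]
          refine Finset.sum_congr rfl fun τ _ => ?_
          rw [Finset.sum_comm]
          refine Finset.sum_congr rfl fun t _ => Finset.sum_congr rfl fun m _ => ?_
          ring
      _ = _ := by
          simp only [P3]
          simp only [Finset.mul_sum]
          rw [Finset.sum_comm]
  have R := L.trans (Finset.sum_le_sum fun τ _ => P1 τ)
  have hK : (0 : ℝ) < (M : ℝ) ^ J := by positivity
  simp only [← mul_div_assoc, ← Finset.sum_div]
  rw [div_le_iff₀ hK, add_mul, div_mul_cancel₀ _ hK.ne']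
  refine R.trans (le_of_eq ?_)
  rw [Finset.sum_add_distrib]
  congr 1
  · simp only [Finset.sum_const, Finset.card_univ, Fintype.card_fun, Fintype.card_fin,
      nsmul_eq_mul, Nat.cast_pow]
    ring
  · rw [← Finset.mul_sum, Finset.sum_comm]
    simp only [← Finset.mul_sum]
end

section
/- Let k ≥ 1 be an integer, β > 0, a₁ > 0, a₂ > 0, and η ∈ (0, 3/((8a₁ + 5a₂)β)]. For t ∈ {1,…,k} set η_t = η·(k−t+1)/k; for t ∈ {0,1,…,k−1} set v_t = 2/(k−t+1) + 1/k, and set v_k = 1 + 1/k (so v_k = v_{k−1}). Define c_t = η_t v_t² − a₁βη_t²v_t² − (1 + a₂η_tβ)(v_t − v_{t−1})·Σ_{s=t}^k η_s v_s. Then c_t ≥ 0 for all t ∈ {1,…,k}, and moreover c_k ≥ η/k. -/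
/-- the coefficients `c_t = η_t v_t² − a₁βη_t²v_t² − (1 + a₂η_tβ)(v_t −
v_{t−1})·Σ_{s=t}^k η_s v_s`, with `η_t = η(k−t+1)/k`, `v_t = 2/(k−t+1) + 1/k` for
`t < k` and `v_k = 1 + 1/k`, are nonnegative for all `t ∈ {1,…,k}`, and `c_k ≥ η/k`. -/
theorem step_weight_coefficients_nonneg (k : ℕ) (hk : 1 ≤ k)
    (β a₁ a₂ η : ℝ) (hβ : 0 < β) (ha₁ : 0 < a₁) (ha₂ : 0 < a₂)
    (hηpos : 0 < η) (hηle : η ≤ 3 / ((8 * a₁ + 5 * a₂) * β))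
    (ηt v c : ℕ → ℝ)
    (hηt : ∀ t, ηt t = η * (((k : ℝ) - (t : ℝ) + 1) / (k : ℝ)))
    (hv : ∀ t, t < k → v t = 2 / ((k : ℝ) - (t : ℝ) + 1) + 1 / (k : ℝ))
    (hvk : v k = 1 + 1 / (k : ℝ))
    (hc : ∀ t, c t = ηt t * (v t) ^ 2 - a₁ * β * (ηt t) ^ 2 * (v t) ^ 2 -
      (1 + a₂ * ηt t * β) * (v t - v (t - 1)) * ∑ s ∈ Finset.Icc t k, ηt s * v s) :
    (∀ t ∈ Finset.Icc 1 k, 0 ≤ c t) ∧ η / (k : ℝ) ≤ c k := by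
  have hk1 : (1:ℝ) ≤ k := by exact_mod_cast hk
  have hk0 : (0:ℝ) < k := by linarith
  have hxy : 8 * (a₁ * β * η) + 5 * (a₂ * β * η) ≤ 3 := by
    rw [le_div_iff₀ (by positivity)] at hηle
    linarith
  have hx : 0 < a₁ * β * η := by positivity
  have hy : 0 < a₂ * β * η := by positivity
  have hck : η / (k : ℝ) ≤ c k := by
    have h1 : v k - v (k - 1) = 0 := by
      rw [hvk, hv (k - 1) (by omega)]
      push_cast [Nat.cast_sub hk]
      ring
    have e : c k = η / k * ((1 + 1 / (k:ℝ)) ^ 2 * (1 - (a₁ * β * η) * (1 / (k:ℝ)))) := by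
      rw [hc, h1, hηt, hvk]
      field_simp
      ring
    have hu0 : 0 < 1 / (k:ℝ) := by positivity
    have hu1 : 1 / (k:ℝ) ≤ 1 := by rw [div_le_one hk0]; exact hk1
    generalize 1 / (k:ℝ) = u at *
    generalize a₁ * β * η = x at *
    have h2 : x * u ≤ 3 / 8 * u := by nlinarith
    have h3 : 1 ≤ (1 + u) ^ 2 * (1 - x * u) := by
      have : (1 + u) ^ 2 * (1 - 3 / 8 * u) ≤ (1 + u) ^ 2 * (1 - x * u) := by gcongr
      nlinarith [mul_pos hu0 hu0, mul_nonneg hu0.le (sub_nonneg.2 hu1),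
        mul_nonneg (mul_pos hu0 hu0).le (sub_nonneg.2 hu1)]
    rw [e]
    have : 0 < η / (k:ℝ) := by positivity
    nlinarith
  refine ⟨?_, hck⟩
  have hS : ∀ d : ℕ, d ≤ k → ∑ s ∈ Finset.Icc (k - d) k, ηt s * v s
      = η / k * (2 * (d:ℝ) + 1 + ((d:ℝ) + 1) * (d + 2) / (2 * k)) := by
    intro d
    induction d with
    | zero =>
      intro _
      simp only [Nat.sub_zero, Finset.Icc_self, Finset.sum_singleton]
      rw [hηt, hvk]
      push_cast
      field_simp
      ring
    | succ d ih =>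
      intro hd
      have hI : Finset.Icc (k - (d + 1)) k = insert (k - (d + 1)) (Finset.Icc (k - d) k) := by
        ext z
        simp only [Finset.mem_Icc, Finset.mem_insert]
        omega
      rw [hI, Finset.sum_insert (by simp only [Finset.mem_Icc]; omega), ih (by omega), hηt,
        hv _ (by omega), Nat.cast_sub hd]
      push_cast
      have e : (k:ℝ) - (k - (d + 1)) + 1 = d + 2 := by ring
      rw [e]
      field_simp
      ring
  intro t ht
  rw [Finset.mem_Icc] at ht
  rcases Nat.lt_or_ge t k with htk | htk
  swap
  · have : t = k := by omega
    rw [this]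
    exact le_trans (by positivity) hck
  obtain ⟨d, hd⟩ : ∃ d, d = k - t := ⟨_, rfl⟩
  have hdt : t = k - d := by omega
  have hdk : d + 1 ≤ k := by omega
  have hmk : (d:ℝ) + 1 ≤ k := by exact_mod_cast hdk
  have htr : (t:ℝ) = k - d := by rw [hdt, Nat.cast_sub (by omega)]
  have hS' := hS d (by omega)
  rw [← hdt] at hS'
  have hd0 : (0:ℝ) ≤ d := Nat.cast_nonneg d
  have e : c t = η / (k * (d + 1)) * ((2 + (d + 1) / (k:ℝ)) ^ 2
      * (1 - (a₁ * β * η) * ((d + 1) / (k:ℝ)))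
      - (1 + (a₂ * β * η) * ((d + 1) / (k:ℝ))) * (4 - 6 / ((d:ℝ) + 2) + (d + 1) / (k:ℝ))) := by
    rw [hc, hS', hηt, hv t htk, hv (t - 1) (by omega), Nat.cast_sub ht.1, htr]
    push_cast
    have e1 : (k:ℝ) - (k - d) + 1 = d + 1 := by ring
    have e2 : (k:ℝ) - (k - d - 1) + 1 = d + 2 := by ring
    rw [e1, e2]
    field_simp
    ring
  rw [e]
  apply mul_nonneg (by positivity)
  have hu0 : 0 < ((d:ℝ) + 1) / k := by positivity
  have hu1 : ((d:ℝ) + 1) / k ≤ 1 := by rw [div_le_one hk0]; exact hmk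
  have hw : 0 < 6 / ((d:ℝ) + 2) := by positivity
  generalize ((d:ℝ) + 1) / k = u at *
  generalize 6 / ((d:ℝ) + 2) = w at *
  generalize a₁ * β * η = x at *
  generalize a₂ * β * η = y at *
  have g1 : (1 + y * u) * (4 - w + u) ≤ (1 + y * u) * (4 + u) := by
    have : 0 < y * u := by positivity
    gcongr
    linarith
  have g3 : u ^ 2 ≤ u := by nlinarith
  have g4 : u ^ 3 ≤ u := by nlinarith
  have g2 : 0 ≤ (3 + u) - x * (2 + u) ^ 2 - y * (4 + u) := by
    nlinarith [mul_nonneg hx.le (sub_nonneg.2 g3), mul_nonneg hx.le (sub_nonneg.2 hu1),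
      mul_nonneg hy.le (sub_nonneg.2 hu1), mul_pos hx hu0, mul_pos hy hu0]
  nlinarith [mul_nonneg hu0.le g2]
end
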